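/- Fix a winner number k with 1 ≤ k ≤ n, a Gini cap g ∈ (0,1), and assume the budgets are strictly ordered with 0 < b_1 < b_2 < … < b_n. Let p*_k = max{p > 0 : g*_k(p) ≤ g}. Then every allocation that is feasible for price p*_k and has flexible Gini index at most g attains the minimum flexible Gini index g*_k(p*_k); consequently the feasible allocation at price p*_k with flexible Gini index at most g is unique: it assigns 0 to agents 1,…,n−k and min{b_i/p*_k, C} to each agent i > n−k, where C is the unique solution of Σ_{i=n−k+1}^n min{b_i/p*_k, C} = 1. -/

import Mathlib

open Finset

/-- The ascending rearrangement of a vector. -/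
noncomputable def sortedAsc {n : ℕ} (a : Fin n → ℝ) : Fin n → ℝ :=
  a ∘ Tuple.sort a

/-- The Gini index of an ascending-sorted nonnegative vector `y` on `Fin k`:
`2 (∑ i, i * y_i) / (k ∑ i, y_i) - (k+1)/k` (with 1-based weights). -/
noncomputable def gini {k : ℕ} (y : Fin k → ℝ) : ℝ :=
  2 * (∑ i : Fin k, (((i : ℕ) : ℝ) + 1) * y i) / (k * ∑ i, y i) - ((k : ℝ) + 1) / k

/-- The flexible Gini index with winner number `k`: the Gini index of the top `k`
entries of the ascending rearrangement of the allocation. -/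
noncomputable def flexGini {n : ℕ} (k : ℕ) (a : Fin n → ℝ) : ℝ :=
  if h : k ≤ n then
    gini (fun i : Fin k => sortedAsc a ⟨n - k + i, by have := i.isLt; omega⟩)
  else 0

/-- Feasibility of allocation `a` for budgets `b`, winner number `k`, price `p`. -/
def Feasible {n : ℕ} (b : Fin n → ℝ) (k : ℕ) (p : ℝ) (a : Fin n → ℝ) : Prop :=
  (∀ i, 0 ≤ a i) ∧ (∑ i, a i = 1) ∧ (∀ i, a i * p ≤ b i) ∧
    n - k ≤ (Finset.univ.filter fun i => a i = 0).card

open Classical in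
/-- The minimum flexible Gini index over feasible allocations (`1` if none exists). -/
noncomputable def gStar {n : ℕ} (b : Fin n → ℝ) (k : ℕ) (p : ℝ) : ℝ :=
  if ∃ a, Feasible b k p a then sInf (flexGini k '' {a | Feasible b k p a}) else 1

/-- The maximum price for winner number `k` under Gini cap `g`. -/
noncomputable def pStar {n : ℕ} (b : Fin n → ℝ) (k : ℕ) (g : ℝ) : ℝ :=
  sSup {p : ℝ | 0 < p ∧ gStar b k p ≤ g}

/-- The Gini mechanism's price: the maximum of `pStar` over allowed winner numbers. -/
noncomputable def pStarK {n : ℕ} (b : Fin n → ℝ) (K : Finset ℕ) (g : ℝ) : ℝ :=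
  sSup ((fun k => pStar b k g) '' (K : Set ℕ))

/-- The `(m+1)`-st smallest budget (0-based index `m`). -/
noncomputable def nthSmallest {n : ℕ} (b : Fin n → ℝ) (m : ℕ) : ℝ :=
  if h : m < n then sortedAsc b ⟨m, h⟩ else 0

/-- The allocation cap `C` at price `p` for winner number `k`. -/
noncomputable def capOf {n : ℕ} (b : Fin n → ℝ) (k : ℕ) (p : ℝ) : ℝ :=
  sInf {C : ℝ | 0 < C ∧
    1 ≤ ∑ i ∈ Finset.univ.filter (fun i : Fin n => n - k ≤ (i : ℕ)),
        min (sortedAsc b i / p) C}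

/-- The winner number chosen by the Gini mechanism (ties broken in favor of more winners). -/
noncomputable def mechWinnerNum {n : ℕ} (b : Fin n → ℝ) (K : Finset ℕ) (g : ℝ) : ℕ :=
  sSup {k | k ∈ K ∧ pStar b k g = pStarK b K g}

/-- The allocation of the Gini mechanism: agents in the bottom `n - k` positions (by budget)
receive `0`; the `k` winners receive `min (bᵢ/p, C)` at the mechanism price `p`. -/
noncomputable def mechAlloc {n : ℕ} (b : Fin n → ℝ) (K : Finset ℕ) (g : ℝ) : Fin n → ℝ :=
  fun i =>
    if ((Tuple.sort b).symm i : ℕ) < n - mechWinnerNum b K g then 0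
    else min (b i / pStarK b K g) (capOf b (mechWinnerNum b K g) (pStarK b K g))

/-- Agent `i`'s spending under the Gini mechanism. -/
noncomputable def spend {n : ℕ} (b : Fin n → ℝ) (K : Finset ℕ) (g : ℝ) (i : Fin n) : ℝ :=
  mechAlloc b K g i * pStarK b K g

/-- Agent `i`'s utility under the Gini mechanism when her valuation is `v`. -/
noncomputable def util {n : ℕ} (b : Fin n → ℝ) (K : Finset ℕ) (g : ℝ) (i : Fin n) (v : ℝ) : ℝ :=
  mechAlloc b K g i * (v - pStarK b K g)


/-- Linear form of the Gini index. -/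
noncomputable def linG {n : ℕ} (k : ℕ) (s : Fin n → ℝ) : ℝ :=
  2 * (∑ i : Fin n, ((i : ℕ) : ℝ) * s i - ((n - k : ℕ) : ℝ) + 1) / k - ((k : ℝ) + 1) / k

lemma sum_top {n k : ℕ} (hkn : k ≤ n) (f : Fin n → ℝ) (h0 : ∀ i : Fin n, (i : ℕ) < n - k → f i = 0) :
    ∑ i : Fin k, f ⟨n - k + i, by have := i.isLt; omega⟩ = ∑ i, f i := by
  have hinj : Function.Injective (fun i : Fin k => (⟨n - k + i, by have := i.isLt; omega⟩ : Fin n)) := by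
    intro i j hij
    simp only [Fin.mk.injEq] at hij
    apply Fin.ext; omega
  refine Fintype.sum_of_injective _ hinj _ _ ?_ ?_
  · intro i hi
    apply h0
    by_contra hc
    apply hi
    refine ⟨⟨i - (n - k), by have := i.isLt; omega⟩, ?_⟩
    apply Fin.ext
    simp only
    omega
  · intro i; rfl

lemma flexGini_eq {n k : ℕ} (hk1 : 1 ≤ k) (hkn : k ≤ n) (a : Fin n → ℝ)
    (h0 : ∀ i : Fin n, (i : ℕ) < n - k → sortedAsc a i = 0) (h1 : ∑ i, sortedAsc a i = 1) :
    flexGini k a = linG k (sortedAsc a) := by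
  unfold flexGini linG gini
  rw [dif_pos hkn]
  rw [sum_top hkn _ h0, h1]
  have : ∑ i : Fin k, (((i : ℕ) : ℝ) + 1) * sortedAsc a ⟨n - k + i, by have := i.isLt; omega⟩
      = ∑ i : Fin n, (((i : ℕ) : ℝ) - ((n - k : ℕ) : ℝ) + 1) * sortedAsc a i := by
    rw [← sum_top hkn (fun i : Fin n => (((i : ℕ) : ℝ) - ((n - k : ℕ) : ℝ) + 1) * sortedAsc a i)
      (by intro i hi; simp [h0 i hi])]
    apply Finset.sum_congr rfl
    intro i _
    push_cast
    ring
  rw [this]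
  have h2 : ∑ i : Fin n, (((i : ℕ) : ℝ) - ((n - k : ℕ) : ℝ) + 1) * sortedAsc a i
      = ∑ i : Fin n, ((i : ℕ) : ℝ) * sortedAsc a i - ((n - k : ℕ) : ℝ) + 1 := by
    have : ∀ i : Fin n, (((i : ℕ) : ℝ) - ((n - k : ℕ) : ℝ) + 1) * sortedAsc a i
      = ((i : ℕ) : ℝ) * sortedAsc a i + (1 - ((n - k : ℕ) : ℝ)) * sortedAsc a i := by
        intro i; ring
    simp only [this, Finset.sum_add_distrib, ← Finset.mul_sum, h1]
    ring
  rw [h2, mul_one]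

lemma sortedAsc_mono {n : ℕ} (a : Fin n → ℝ) : Monotone (sortedAsc a) := Tuple.monotone_sort a

lemma sortedAsc_of_mono {n : ℕ} {a : Fin n → ℝ} (h : Monotone a) : sortedAsc a = a := by
  unfold sortedAsc
  rw [Tuple.sort_eq_refl_iff_monotone.mpr h]
  rfl

lemma sum_sortedAsc {n : ℕ} (a : Fin n → ℝ) : ∑ i, sortedAsc a i = ∑ i, a i :=
  Equiv.sum_comp (Tuple.sort a) a

/-- Sorted vectors respect the budgets. -/
lemma sorted_le {n : ℕ} {a c : Fin n → ℝ} (hc : Monotone c) (h : ∀ i, a i ≤ c i) (q : Fin n) :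
    sortedAsc a q ≤ c q := by
  have : ∃ r, q ≤ r ∧ Tuple.sort a r ≤ q := by
    by_contra hcon
    push Not at hcon
    have hcard : (Finset.Ici q).card ≤ (Finset.Ioi q).card := by
      apply Finset.card_le_card_of_injOn (Tuple.sort a)
      · intro r hr
        simp only [Finset.coe_Ici, Set.mem_Ici] at hr
        simpa using hcon r hr
      · exact (Tuple.sort a).injective.injOn
    simp only [Fin.card_Ici, Fin.card_Ioi] at hcard
    have := q.isLt
    omega
  obtain ⟨r, hr, hr2⟩ := this
  exact ((sortedAsc_mono a hr).trans (h _)).trans (hc hr2)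

/-- Zeros come first. -/
lemma sorted_zero {n : ℕ} {a : Fin n → ℝ} (ha : ∀ i, 0 ≤ a i) (m : ℕ)
    (h : m ≤ (Finset.univ.filter fun i => a i = 0).card) (q : Fin n) (hq : (q : ℕ) < m) :
    sortedAsc a q = 0 := by
  by_contra hne
  have hpos : 0 < sortedAsc a q := lt_of_le_of_ne (ha _) (Ne.symm hne)
  have hcard : (Finset.univ.filter fun i => a i = 0).card ≤ (Finset.Iio q).card := by
    apply Finset.card_le_card_of_injOn (Tuple.sort a).symm
    · intro r hr
      simp only [Finset.coe_filter, Finset.mem_univ, true_and, Set.mem_ofPred_eq] at hr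
      simp only [Finset.coe_Iio, Set.mem_Iio]
      by_contra hc
      push Not at hc
      have := sortedAsc_mono a hc
      simp only [sortedAsc, Function.comp, Equiv.apply_symm_apply] at this hpos
      linarith
    · exact (Tuple.sort a).symm.injective.injOn
  simp only [Fin.card_Iio] at hcard
  omega

/-- Dominance: single crossing. -/
lemma dominance {n : ℕ} {s x : Fin n → ℝ} (hsum : ∑ i, s i = ∑ i, x i)
    (hcross : ∀ i j, i ≤ j → x i < s i → x j < s j) :
    (∑ i : Fin n, ((i : ℕ) : ℝ) * x i ≤ ∑ i : Fin n, ((i : ℕ) : ℝ) * s i) ∧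
    (∑ i : Fin n, ((i : ℕ) : ℝ) * s i ≤ ∑ i : Fin n, ((i : ℕ) : ℝ) * x i → s = x) := by
  by_cases hex : ∀ i, s i ≤ x i
  · have : s = x := by
      funext i
      exact (Finset.sum_eq_sum_iff_of_le (fun i _ => hex i)).mp hsum i (Finset.mem_univ i)
    subst this
    simp
  · push Not at hex
    obtain ⟨t, ht⟩ : ∃ t : Fin n, (∀ i, i < t → s i ≤ x i) ∧ (∀ i, t ≤ i → x i < s i) := by
      classical
      have hne : (Finset.univ.filter fun i => x i < s i).Nonempty := by
        obtain ⟨i, hi⟩ := hex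
        exact ⟨i, by simpa using hi⟩
      refine ⟨(Finset.univ.filter fun i => x i < s i).min' hne, ?_, ?_⟩
      · intro i hi
        by_contra hc
        push Not at hc
        have := Finset.min'_le (Finset.univ.filter fun i => x i < s i) i (by simpa using hc)
        exact absurd hi (not_lt.mpr this)
      · intro i hi
        refine hcross _ _ hi ?_
        have := Finset.min'_mem _ hne
        simpa using this
    have key : ∑ i : Fin n, ((i : ℕ) : ℝ) * s i - ∑ i : Fin n, ((i : ℕ) : ℝ) * x i
        = ∑ i : Fin n, (((i : ℕ) : ℝ) - ((t : ℕ) : ℝ)) * (s i - x i) := by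
      have : ∀ i : Fin n, (((i : ℕ) : ℝ) - ((t : ℕ) : ℝ)) * (s i - x i)
        = (((i : ℕ) : ℝ) * s i - ((i : ℕ) : ℝ) * x i) - (((t : ℕ) : ℝ) * s i - ((t : ℕ) : ℝ) * x i) := by
        intro i; ring
      simp only [this, Finset.sum_sub_distrib, ← Finset.mul_sum, hsum]
      ring
    have hnn : ∀ i : Fin n, 0 ≤ (((i : ℕ) : ℝ) - ((t : ℕ) : ℝ)) * (s i - x i) := by
      intro i
      rcases lt_or_ge i t with h | h
      · have h1 := ht.1 i h
        have h2 : ((i : ℕ) : ℝ) < ((t : ℕ) : ℝ) := by exact_mod_cast h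
        exact mul_nonneg_of_nonpos_of_nonpos (by linarith) (by linarith)
      · have h1 := ht.2 i h
        have h2 : ((t : ℕ) : ℝ) ≤ ((i : ℕ) : ℝ) := by exact_mod_cast h
        exact mul_nonneg (by linarith) (by linarith)
    have hS := Finset.sum_nonneg (fun i (_ : i ∈ Finset.univ) => hnn i)
    refine ⟨by linarith, fun hle => ?_⟩
    have hz := (Finset.sum_eq_zero_iff_of_nonneg (fun i (_ : i ∈ Finset.univ) => hnn i)).mp
      (by linarith)
    have hne : ∀ i, i ≠ t → s i - x i = 0 := by
      intro i hi
      rcases mul_eq_zero.mp (hz i (Finset.mem_univ i)) with h | h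
      · exfalso; apply hi; apply Fin.ext
        have : ((i : ℕ) : ℝ) = ((t : ℕ) : ℝ) := by linarith
        exact_mod_cast this
      · exact h
    have h3 : ∑ i, (s i - x i) = s t - x t :=
      Finset.sum_eq_single t (fun i _ hi => hne i hi) (by simp)
    rw [Finset.sum_sub_distrib, hsum, sub_self] at h3
    have := ht.2 t le_rfl
    linarith

lemma feas_flexGini {n k : ℕ} (hk1 : 1 ≤ k) (hkn : k ≤ n) {b a : Fin n → ℝ} {p : ℝ}
    (h : Feasible b k p a) : flexGini k a = linG k (sortedAsc a) :=
  flexGini_eq hk1 hkn a (fun i hi => sorted_zero h.1 _ h.2.2.2 i hi)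
    (by rw [sum_sortedAsc]; exact h.2.1)

lemma feas_bdd {n k : ℕ} (hk1 : 1 ≤ k) (hkn : k ≤ n) (b : Fin n → ℝ) (p : ℝ) :
    BddBelow (flexGini k '' {a | Feasible b k p a}) := by
  refine ⟨2 * (0 - ((n - k : ℕ) : ℝ) + 1) / k - ((k : ℝ) + 1) / k, ?_⟩
  rintro _ ⟨a, ha, rfl⟩
  rw [feas_flexGini hk1 hkn ha]
  unfold linG
  have : 0 ≤ ∑ i : Fin n, ((i : ℕ) : ℝ) * sortedAsc a i :=
    Finset.sum_nonneg fun i _ => mul_nonneg (by positivity) (ha.1 _)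
  gcongr

/-- Feasibility of an allocation supported on the top `k`. -/
lemma feas_of {n k : ℕ} (hkn : k ≤ n) {b a : Fin n → ℝ} {p : ℝ}
    (h0 : ∀ i : Fin n, (i : ℕ) < n - k → a i = 0) (hnn : ∀ i, 0 ≤ a i) (h1 : ∑ i, a i = 1)
    (hb : ∀ i, a i * p ≤ b i) : Feasible b k p a := by
  refine ⟨hnn, h1, hb, ?_⟩
  have : (Finset.univ : Finset (Fin (n - k))).card ≤ (Finset.univ.filter fun i => a i = 0).card := by
    apply Finset.card_le_card_of_injOn (Fin.castLE (Nat.sub_le n k))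
    · intro i _
      simp only [Finset.coe_filter, Finset.mem_univ, true_and, Set.mem_ofPred_eq]
      exact h0 _ i.isLt
    · exact (Fin.castLE_injective _).injOn
  simpa using this

lemma sum_ite_top {n : ℕ} (m : ℕ) (f : Fin n → ℝ) :
    ∑ i : Fin n, (if (i : ℕ) < m then 0 else f i)
      = ∑ i ∈ Finset.univ.filter (fun i : Fin n => m ≤ (i : ℕ)), f i := by
  rw [Finset.sum_filter]
  apply Finset.sum_congr rfl
  intro i _
  split_ifs <;> first | rfl | omega

lemma mono_ite_top {n : ℕ} (m : ℕ) {f : Fin n → ℝ} (hf : Monotone f) (h0 : ∀ i, 0 ≤ f i) :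
    Monotone (fun i : Fin n => if (i : ℕ) < m then 0 else f i) := by
  intro i j hij
  have hij' : (i : ℕ) ≤ j := hij
  simp only
  split_ifs with h1 h2 h2
  · exact le_rfl
  · exact h0 j
  · omega
  · exact hf hij

/-- A constant top part has Gini index zero. -/
lemma flexGini_const {n k : ℕ} (hk1 : 1 ≤ k) (hkn : k ≤ n) {x : Fin n → ℝ} (hx : Monotone x) {C : ℝ}
    (hC : 0 < C) (h : ∀ i : Fin n, n - k ≤ (i : ℕ) → x i = C) : flexGini k x = 0 := by
  unfold flexGini gini
  rw [dif_pos hkn, sortedAsc_of_mono hx]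
  have hy : ∀ i : Fin k, x ⟨n - k + i, by have := i.isLt; omega⟩ = C := fun i => h _ (by simp)
  simp only [hy, ← Finset.sum_mul, Finset.sum_const, Finset.card_univ, Fintype.card_fin, nsmul_eq_mul]
  have hs : ∑ i : Fin k, (((i : ℕ) : ℝ) + 1) = k * (k + 1) / 2 := by
    rw [Fin.sum_univ_eq_sum_range (fun i : ℕ => (i : ℝ) + 1) k]
    clear hy h hk1 hkn
    induction k with
    | zero => simp
    | succ k ih => rw [Finset.sum_range_succ, ih]; push_cast; ring
  rw [hs]
  have : (k : ℝ) ≠ 0 := by positivity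
  field_simp
  ring

/-- With strictly ordered positive budgets, at the maximum price `p*_k` every
feasible allocation with flexible Gini index at most `g` attains the minimum flexible Gini index
`g*_k(p*_k)`, and it is unique: it assigns `0` to agents `1, …, n-k` and `min (bᵢ/p*_k) C` to
each agent `i > n-k`, where `C` solves `∑_{i=n-k+1}^n min (bᵢ/p*_k) C = 1`. -/
theorem allocation_unique_at_maxPrice {n : ℕ} (b : Fin n → ℝ) (hmono : StrictMono b)
    (hpos : ∀ i, 0 < b i) (k : ℕ) (hk1 : 1 ≤ k) (hkn : k ≤ n)
    (g : ℝ) (hg : g ∈ Set.Ioo (0 : ℝ) 1) (pstar : ℝ)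
    (hpstar : IsGreatest {p : ℝ | 0 < p ∧ gStar b k p ≤ g} pstar)
    (C : ℝ) (hC : 0 < C)
    (hCeq : ∑ i ∈ Finset.univ.filter (fun i : Fin n => n - k ≤ (i : ℕ)),
        min (b i / pstar) C = 1) :
    ∀ a : Fin n → ℝ, Feasible b k pstar a → flexGini k a ≤ g →
      flexGini k a = gStar b k pstar ∧
      ∀ i : Fin n, a i = if (i : ℕ) < n - k then 0 else min (b i / pstar) C := by
  intro a ha hag
  have hp : 0 < pstar := hpstar.1.1
  set p := pstar with hpdef
  have hk0 : (0 : ℝ) < k := by exact_mod_cast hk1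
  obtain ⟨x, hx⟩ : ∃ x : Fin n → ℝ, x = fun i : Fin n => if (i : ℕ) < n - k then 0 else min (b i / p) C :=
    ⟨_, rfl⟩
  have hbp : Monotone fun i => b i / p := fun i j hij =>
    div_le_div_of_nonneg_right (hmono.monotone hij) hp.le
  have hbp0 : ∀ i, 0 < b i / p := fun i => div_pos (hpos i) hp
  have hxm : Monotone x := by
    rw [hx]
    refine mono_ite_top _ (f := fun i => min (b i / p) C) ?_ ?_
    · intro i j hij; exact min_le_min (hbp hij) le_rfl
    · intro i; exact le_min (hbp0 i).le hC.le
  have hx0 : ∀ i : Fin n, (i : ℕ) < n - k → x i = 0 := by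
    intro i hi; rw [hx]; simp [hi]
  have hx2 : ∀ i : Fin n, n - k ≤ (i : ℕ) → x i = min (b i / p) C := by
    intro i hi; rw [hx]; simp [not_lt.mpr hi]
  have hxnn : ∀ i, 0 ≤ x i := by
    intro i
    rcases lt_or_ge (i : ℕ) (n - k) with h | h
    · rw [hx0 i h]
    · rw [hx2 i h]; exact le_min (hbp0 i).le hC.le
  have hxb : ∀ i, x i ≤ b i / p := by
    intro i
    rcases lt_or_ge (i : ℕ) (n - k) with h | h
    · rw [hx0 i h]; exact (hbp0 i).le
    · rw [hx2 i h]; exact min_le_left _ _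
  have hxC : ∀ i, x i ≤ C := by
    intro i
    rcases lt_or_ge (i : ℕ) (n - k) with h | h
    · rw [hx0 i h]; exact hC.le
    · rw [hx2 i h]; exact min_le_right _ _
  have hx1 : ∑ i, x i = 1 := by rw [hx, sum_ite_top, hCeq]
  have hxf : Feasible b k p x :=
    feas_of hkn hx0 hxnn hx1 fun i => (le_div_iff₀ hp).mp (hxb i)
  have hGx : flexGini k x = linG k x := by
    rw [feas_flexGini hk1 hkn hxf, sortedAsc_of_mono hxm]
  have hle_of : ∀ a', Feasible b k p a' → ∀ i, sortedAsc a' i ≤ b i / p := fun a' ha' i =>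
    sorted_le hbp (fun j => (le_div_iff₀ hp).mpr (ha'.2.2.1 j)) i
  have hdom : ∀ a', Feasible b k p a' →
      linG k x ≤ linG k (sortedAsc a') ∧ (linG k (sortedAsc a') ≤ linG k x → sortedAsc a' = x) := by
    intro a' ha'
    have hd := dominance (s := sortedAsc a') (x := x)
      (by rw [sum_sortedAsc, ha'.2.1, hx1]) (by
        intro i j hij hi
        have hik : n - k ≤ (i : ℕ) := by
          by_contra hc
          have h1 := sorted_zero ha'.1 _ ha'.2.2.2 i (not_le.mp hc)
          have := hxnn i
          linarith
        have h2 := hle_of a' ha' i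
        rw [hx2 i hik] at hi
        have h3 : C < sortedAsc a' i := by
          rcases min_lt_iff.mp hi with h | h
          · linarith
          · exact h
        have := sortedAsc_mono a' hij
        have := hxC j
        linarith)
    refine ⟨?_, fun h => hd.2 ?_⟩
    · unfold linG
      have := hd.1
      gcongr
    · unfold linG at h
      have h4 := (div_le_div_iff_of_pos_right hk0).mp (sub_le_sub_iff_right _ |>.mp h)
      linarith
  have hgs : gStar b k p = flexGini k x := by
    unfold gStar
    rw [if_pos ⟨x, hxf⟩]
    apply IsLeast.csInf_eq
    refine ⟨⟨x, hxf, rfl⟩, ?_⟩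
    rintro _ ⟨a', ha', rfl⟩
    rw [hGx, feas_flexGini hk1 hkn ha']
    exact (hdom a' ha').1
  have hGa := feas_flexGini hk1 hkn ha
  have hmn : n - k < n := by omega
  obtain ⟨m, hm⟩ : ∃ m : Fin n, (m : ℕ) = n - k := ⟨⟨n - k, hmn⟩, rfl⟩
  -- the main claim
  have hclaim : sortedAsc a = x ∧ b m / p ≤ C := by
    obtain ⟨T, hT⟩ : ∃ T, T = ∑ i ∈ Finset.univ.filter (fun i : Fin n => n - k ≤ (i : ℕ)), b i / p :=
      ⟨_, rfl⟩
    have hT1 : 1 ≤ T := by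
      rw [hT, ← hCeq]
      exact Finset.sum_le_sum fun i _ => min_le_left _ _
    rcases hT1.eq_or_lt with hT1 | hT1
    · have hall : ∀ i : Fin n, n - k ≤ (i : ℕ) → min (b i / p) C = b i / p := by
        intro i hi
        refine (Finset.sum_eq_sum_iff_of_le (fun i _ => min_le_left (b i / p) C)).mp
          (by rw [hCeq, hT1, hT]) i (by simpa using hi)
      have hmC : b m / p ≤ C := by
        rw [← hall m hm.ge]; exact min_le_right _ _
      refine ⟨?_, hmC⟩
      have hsx : ∀ i, sortedAsc a i ≤ x i := by
        intro i
        rcases lt_or_ge (i : ℕ) (n - k) with h | h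
        · rw [hx0 i h, sorted_zero ha.1 _ ha.2.2.2 i h]
        · rw [hx2 i h, hall i h]; exact hle_of a ha i
      funext i
      exact (Finset.sum_eq_sum_iff_of_le (fun i _ => hsx i)).mp
        (by rw [sum_sortedAsc, ha.2.1, hx1]) i (Finset.mem_univ i)
    · have hgx : g ≤ linG k x := by
        by_contra hlt
        push Not at hlt
        obtain ⟨z, hz⟩ : ∃ z : Fin n → ℝ,
            z = fun i : Fin n => if (i : ℕ) < n - k then 0 else b i / p / T := ⟨_, rfl⟩
        have hT0 : 0 < T := by linarith
        have hz0 : ∀ i : Fin n, (i : ℕ) < n - k → z i = 0 := by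
          intro i hi; rw [hz]; simp [hi]
        have hzT : ∀ i, 0 ≤ z i ∧ z i ≤ b i / p / T := by
          intro i
          have := div_pos (hbp0 i) hT0
          rw [hz]; simp only
          split_ifs
          · exact ⟨le_rfl, this.le⟩
          · exact ⟨this.le, le_rfl⟩
        have hzm : Monotone z := by
          rw [hz]
          refine mono_ite_top _ (f := fun i => b i / p / T) ?_ ?_
          · intro i j hij; exact div_le_div_of_nonneg_right (hbp hij) hT0.le
          · intro i; exact (div_pos (hbp0 i) hT0).le
        have hz1 : ∑ i, z i = 1 := by
          rw [hz, sum_ite_top, ← Finset.sum_div, ← hT, div_self hT0.ne']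
        obtain ⟨e, he0, he1, hele⟩ : ∃ e : ℝ, 0 < e ∧ e < 1 ∧ e * (linG k z - linG k x) ≤ g - linG k x := by
          have hd : 0 < |linG k z - linG k x| + 1 := by positivity
          refine ⟨min (1/2) ((g - linG k x) / (|linG k z - linG k x| + 1)), ?_, ?_, ?_⟩
          · exact lt_min (by norm_num) (div_pos (by linarith) hd)
          · exact (min_le_left _ _).trans_lt (by norm_num)
          · have hpos' : 0 ≤ min (1/2) ((g - linG k x) / (|linG k z - linG k x| + 1)) :=
              le_min (by norm_num) (div_pos (by linarith) hd).le
            calc _ ≤ min (1/2) ((g - linG k x) / (|linG k z - linG k x| + 1))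
                  * (|linG k z - linG k x| + 1) := by
                    apply mul_le_mul_of_nonneg_left _ hpos'
                    have := le_abs_self (linG k z - linG k x)
                    linarith
              _ ≤ ((g - linG k x) / (|linG k z - linG k x| + 1)) * (|linG k z - linG k x| + 1) :=
                    mul_le_mul_of_nonneg_right (min_le_right _ _) hd.le
              _ = _ := div_mul_cancel₀ _ hd.ne'
        obtain ⟨w, hw⟩ : ∃ w : Fin n → ℝ, w = fun i => (1 - e) * x i + e * z i := ⟨_, rfl⟩
        have hwm : Monotone w := by
          rw [hw]
          intro i j hij
          have h1 := mul_le_mul_of_nonneg_left (hxm hij) (by linarith : 0 ≤ 1 - e)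
          have h2 := mul_le_mul_of_nonneg_left (hzm hij) he0.le
          simp only; linarith
        have hw1 : ∑ i, w i = 1 := by
          rw [hw, Finset.sum_add_distrib, ← Finset.mul_sum, ← Finset.mul_sum, hx1, hz1]; ring
        have hwl : linG k w = (1 - e) * linG k x + e * linG k z := by
          have : ∑ i : Fin n, ((i : ℕ) : ℝ) * w i = (1 - e) * ∑ i : Fin n, ((i : ℕ) : ℝ) * x i
              + e * ∑ i : Fin n, ((i : ℕ) : ℝ) * z i := by
            rw [Finset.mul_sum, Finset.mul_sum, ← Finset.sum_add_distrib, hw]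
            apply Finset.sum_congr rfl
            intro i _
            ring
          unfold linG
          rw [this]
          ring
        obtain ⟨d, hd⟩ : ∃ d : ℝ, d = 1 - e + e / T := ⟨_, rfl⟩
        have heT : e / T < e := div_lt_self he0 hT1
        have heT0 : 0 < e / T := div_pos he0 hT0
        have hd0 : 0 < d := by rw [hd]; linarith
        have hd1 : d < 1 := by rw [hd]; linarith
        have hwf : Feasible b k (p / d) w := by
          refine feas_of hkn ?_ ?_ hw1 ?_
          · intro i hi; rw [hw]; simp [hx0 i hi, hz0 i hi]
          · intro i
            rw [hw]
            exact add_nonneg (mul_nonneg (by linarith) (hxnn i)) (mul_nonneg he0.le (hzT i).1)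
          · intro i
            have h1 : w i ≤ b i / p * d := by
              rw [hw, hd]
              have h1 := mul_le_mul_of_nonneg_left (hxb i) (by linarith : 0 ≤ 1 - e)
              have h2 := mul_le_mul_of_nonneg_left (hzT i).2 he0.le
              calc _ ≤ (1 - e) * (b i / p) + e * (b i / p / T) := add_le_add h1 h2
                _ = _ := by ring
            calc w i * (p / d) ≤ (b i / p * d) * (p / d) :=
                  mul_le_mul_of_nonneg_right h1 (div_pos hp hd0).le
              _ = b i := by field_simp
        have hmem : p / d ∈ {p : ℝ | 0 < p ∧ gStar b k p ≤ g} := by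
          refine ⟨div_pos hp hd0, ?_⟩
          unfold gStar
          rw [if_pos ⟨w, hwf⟩]
          refine (csInf_le (feas_bdd hk1 hkn b _) ⟨w, hwf, rfl⟩).trans ?_
          rw [feas_flexGini hk1 hkn hwf, sortedAsc_of_mono hwm, hwl]
          linarith
        have h1 := hpstar.2 hmem
        have h2 : p < p / d := by
          rw [lt_div_iff₀ hd0]
          nlinarith
        linarith
      refine ⟨(hdom a ha).2 (by rw [← hGa]; linarith), ?_⟩
      by_contra hc
      push Not at hc
      have : flexGini k x = 0 := by
        refine flexGini_const hk1 hkn hxm hC fun i hi => ?_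
        rw [hx2 i hi]
        apply min_eq_right
        have hmi : m ≤ i := by
          rw [Fin.le_def, hm]; exact hi
        exact hc.le.trans (hbp hmi)
      have := hg.1
      linarith
  obtain ⟨hsx, hmC⟩ := hclaim
  refine ⟨by rw [hgs, hGa, hGx, hsx], ?_⟩
  have hval : ∀ i, a i = x ((Tuple.sort a).symm i) := by
    intro i
    rw [← hsx]; simp [sortedAsc]
  have hax : ∀ i, a i ≤ x i := by
    intro i
    rcases lt_or_ge (i : ℕ) (n - k) with h | h
    · rw [hx0 i h, hval i]
      apply le_of_eq
      apply hx0
      by_contra hc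
      push Not at hc
      have h1 : m ≤ (Tuple.sort a).symm i := by rw [Fin.le_def, hm]; exact hc
      have h2 := hxm h1
      rw [hx2 m hm.ge, min_eq_left hmC, ← hval i] at h2
      have h3 := ha.2.2.1 i
      have h4 : b i < b m := hmono (by rw [Fin.lt_def, hm]; exact h)
      have h5 := (div_le_iff₀ hp).mp h2
      linarith
    · rw [hx2 i h]
      refine le_min ((le_div_iff₀ hp).mpr (ha.2.2.1 i)) ?_
      rw [hval i]; exact hxC _
  intro i
  have := (Finset.sum_eq_sum_iff_of_le (fun i _ => hax i)).mp
        (by rw [ha.2.1, hx1]) i (Finset.mem_univ i)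
  rw [this, hx]
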